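/- Let r ≤ n and k ≤ r be natural numbers and σ : Fin r → ℝ with σ i ≠ 0 for every i with (i : ℕ) < k. Let U ∈ ℝ^{r×r} satisfy Uᵀ · U = 1, let V ∈ ℝ^{n×n} satisfy Vᵀ · V = 1, let Σ_k ∈ ℝ^{r×n} be given by (Σ_k) i j = σ i if (i : ℕ) = (j : ℕ) and (i : ℕ) < k, and 0 otherwise, and set Ã = U · Σ_k · Vᵀ. Let U_k ∈ ℝ^{r×k} be the submatrix of the first k columns of U. Then for every real matrix B ∈ ℝ^{m×r}, the column space of B · U_k equals the column space of B · Ã: LinearMap.range (mulVecLin (B * U_k)) = LinearMap.range (mulVecLin (B * Ã)). -/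

import Mathlib

open Matrix

/-- The column space of a product is contained in that of its left factor. -/
theorem Matrix.range_mulVecLin_mul_le {R l m n : Type*} [CommSemiring R] [Fintype m] [Fintype n]
    (M : Matrix l m R) (N : Matrix m n R) :
    LinearMap.range (M * N).mulVecLin ≤ LinearMap.range M.mulVecLin := by
  rw [Matrix.mulVecLin_mul]
  exact LinearMap.range_comp_le_range _ _

/-- Proposition A.2 (Equivalence to Principal Subspace Restriction): with
`Uᵀ U = 1`, `Vᵀ V = 1`, `Σ_k` the truncated rectangular diagonal matrix of
the (nonzero) top-`k` singular values, `Ã = U Σ_k Vᵀ`, and `U_k` the first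
`k` columns of `U`, for any `B` the column space of `B U_k` equals the
column space of `B Ã`. -/
theorem column_space_restrict_eq_truncation
    {r n k m : ℕ} (hrn : r ≤ n) (hk : k ≤ r) (σ : Fin r → ℝ)
    (hσ : ∀ i : Fin r, (i : ℕ) < k → σ i ≠ 0)
    (U : Matrix (Fin r) (Fin r) ℝ) (hU : Uᵀ * U = 1)
    (V : Matrix (Fin n) (Fin n) ℝ) (hV : Vᵀ * V = 1)
    (Sk : Matrix (Fin r) (Fin n) ℝ)
    (hSk : ∀ i j, Sk i j = if (i : ℕ) = (j : ℕ) ∧ (i : ℕ) < k then σ i else 0)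
    (B : Matrix (Fin m) (Fin r) ℝ) :
    LinearMap.range (B * U.submatrix id (Fin.castLE hk)).mulVecLin
      = LinearMap.range (B * (U * Sk * Vᵀ)).mulVecLin := by
  set P : Matrix (Fin r) (Fin k) ℝ := (1 : Matrix (Fin r) (Fin r) ℝ).submatrix id (Fin.castLE hk)
    with hP
  have hUP : U.submatrix id (Fin.castLE hk) = U * P := by
    ext i a
    simp [hP, Matrix.mul_apply, Matrix.one_apply]
  have hSkP : Sk = P * Sk.submatrix (Fin.castLE hk) id := by
    ext i j
    simp only [hP, Matrix.mul_apply, Matrix.submatrix_apply, id, Matrix.one_apply, ite_mul,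
      one_mul, zero_mul]
    by_cases hi : (i : ℕ) < k
    · rw [Finset.sum_eq_single ⟨i, hi⟩]
      · simp
      · intro a _ ha
        rw [if_neg]
        rintro rfl
        exact ha rfl
      · simp
    · rw [Finset.sum_eq_zero, hSk, if_neg (fun h => hi h.2)]
      intro a _
      rw [if_neg]
      rintro rfl
      exact hi a.2
  obtain ⟨E, hE⟩ : ∃ E : Matrix (Fin n) (Fin k) ℝ, P = Sk * E := by
    refine ⟨Matrix.of fun j a => if (j : ℕ) = a then (σ (Fin.castLE hk a))⁻¹ else 0, ?_⟩
    ext i a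
    rw [Matrix.mul_apply, Finset.sum_eq_single (Fin.castLE (hk.trans hrn) a)]
    · by_cases h : i = Fin.castLE hk a
      · subst h
        simp [hP, hSk, hσ, Matrix.one_apply]
      · have h_val : (i : ℕ) ≠ a := fun e => h (Fin.ext e)
        simp [hP, hSk, h, h_val]
    · intro j _ hj
      have h_val : (j : ℕ) ≠ a := fun e => hj (Fin.ext e)
      simp [h_val]
    · simp
  rw [hUP]
  apply le_antisymm
  · have h : B * (U * P) = B * (U * Sk * Vᵀ) * (V * E) := by
      simp only [Matrix.mul_assoc]
      rw [← Matrix.mul_assoc Vᵀ, hV, Matrix.one_mul, ← hE]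
    rw [h]
    exact Matrix.range_mulVecLin_mul_le _ _
  · have h : B * (U * Sk * Vᵀ) = B * (U * P) * (Sk.submatrix (Fin.castLE hk) id * Vᵀ) := by
      conv_lhs => rw [hSkP]
      simp only [Matrix.mul_assoc]
    rw [h]
    exact Matrix.range_mulVecLin_mul_le _ _
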